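/- Let α ≥ 3/2 be a real number. Let G be a finite simple 2-edge-connected graph with 0/1 edge weights whose zero-edges form a matching, let u be a vertex of G, and suppose V(G) \ {u} = V1 ∪ V2 where V1 and V2 are disjoint and nonempty and no edge of G joins a vertex of V1 to a vertex of V2. Write H1 = G[V1 ∪ {u}] and H2 = G[V2 ∪ {u}]. If, for i = 1, 2, Fi is a 2-edge-connected spanning subgraph of Hi with ||Fi|| ≤ max(α·opt(Hi) − 2, opt(Hi)), then F1 ∪ F2 is a 2-edge-connected spanning subgraph of G with ||F1 ∪ F2|| ≤ max(α·opt(G) − 2, opt(G)). -/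

import Mathlib

open scoped Classical

/-- Weight of an edge set: sum of the 0/1 weights of its edges. -/
def wt {V : Type*} (w : Sym2 V → ℕ) (F : Finset (Sym2 V)) : ℕ := ∑ e ∈ F, w e

/-- `F` is (the edge set of) a 2-edge-connected spanning subgraph of `G`. -/
def IsTwoECSS {V : Type*} [Fintype V] (G : SimpleGraph V) (F : Finset (Sym2 V)) : Prop :=
  (↑F : Set (Sym2 V)) ⊆ G.edgeSet ∧
    (SimpleGraph.fromEdgeSet (↑F : Set (Sym2 V))).Connected ∧
    2 ≤ Fintype.card V ∧
    ∀ e ∈ F, ((SimpleGraph.fromEdgeSet (↑F : Set (Sym2 V))).deleteEdges {e}).Connected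

/-- A graph is 2-edge-connected: connected, ≥ 2 vertices, and no bridges. -/
def TwoEdgeConnected {V : Type*} [Fintype V] (G : SimpleGraph V) : Prop :=
  G.Connected ∧ 2 ≤ Fintype.card V ∧ ∀ e ∈ G.edgeSet, (G.deleteEdges {e}).Connected

/-- The zero-edges of `G` (w.r.t. weight `w`) form a matching. -/
def ZeroEdgesMatching {V : Type*} (G : SimpleGraph V) (w : Sym2 V → ℕ) : Prop :=
  ∀ e ∈ G.edgeSet, ∀ f ∈ G.edgeSet, w e = 0 → w f = 0 → e ≠ f → ∀ v : V, ¬(v ∈ e ∧ v ∈ f)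

/-- The minimum weight of a 2-edge-connected spanning subgraph of `G`. -/
noncomputable def opt {V : Type*} [Fintype V] (G : SimpleGraph V) (w : Sym2 V → ℕ) : ℕ :=
  sInf {n | ∃ F : Finset (Sym2 V), IsTwoECSS G F ∧ wt w F = n}

theorem conn_push {V W : Type*} {K : SimpleGraph V} {L : SimpleGraph W} (f : V → W)
    (hf : Function.Surjective f) (h : ∀ a b, K.Adj a b → L.Reachable (f a) (f b))
    (hK : K.Connected) : L.Connected := by
  have key : ∀ a b, K.Reachable a b → L.Reachable (f a) (f b) := by
    rintro a b ⟨p⟩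
    induction p with
    | nil => exact SimpleGraph.Reachable.refl _
    | cons hadj _ ih => exact (h _ _ hadj).trans ih
  haveI := hK.nonempty
  haveI : Nonempty W := Nonempty.map f inferInstance
  refine ⟨fun x y => ?_⟩
  obtain ⟨a, rfl⟩ := hf x
  obtain ⟨b, rfl⟩ := hf y
  exact key a b (hK.preconnected a b)

theorem reach_part {V : Type*} (S : Set V) [Fintype S] (H : SimpleGraph S)
    (F : Finset (Sym2 S)) (hF : IsTwoECSS H F) (e : Sym2 V) (E : Finset (Sym2 V))
    (hE : F.image (Sym2.map Subtype.val) ⊆ E) (a b : S) :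
    ((SimpleGraph.fromEdgeSet (↑E : Set (Sym2 V))).deleteEdges {e}).Reachable a b := by
  obtain ⟨-, hc, -, hd⟩ := hF
  have hinj : Function.Injective (Sym2.map (Subtype.val : S → V)) :=
    Sym2.map.injective Subtype.val_injective
  have key : ∀ L : SimpleGraph S, L.Connected →
      (∀ x y, L.Adj x y → s(x, y) ∈ F ∧ x ≠ y ∧ s((x : V), (y : V)) ≠ e) →
      ((SimpleGraph.fromEdgeSet (↑E : Set (Sym2 V))).deleteEdges {e}).Reachable a b := by
    intro L hL h
    let φ : L →g ((SimpleGraph.fromEdgeSet (↑E : Set (Sym2 V))).deleteEdges {e}) :=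
      { toFun := Subtype.val
        map_rel' := by
          intro x y hxy
          obtain ⟨h1, h2, h3⟩ := h x y hxy
          rw [SimpleGraph.deleteEdges_adj, SimpleGraph.fromEdgeSet_adj]
          refine ⟨⟨?_, fun h => h2 (Subtype.ext h)⟩, h3⟩
          exact hE (Finset.mem_image.2 ⟨s(x, y), h1, rfl⟩) }
    exact (hL.preconnected a b).map φ
  by_cases h : ∃ e' ∈ F, Sym2.map Subtype.val e' = e
  · obtain ⟨e', he', rfl⟩ := h
    refine key _ (hd e' he') ?_
    intro x y hxy
    rw [SimpleGraph.deleteEdges_adj, SimpleGraph.fromEdgeSet_adj] at hxy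
    exact ⟨hxy.1.1, hxy.1.2, fun h => hxy.2 (hinj h)⟩
  · refine key _ hc ?_
    intro x y hxy
    rw [SimpleGraph.fromEdgeSet_adj] at hxy
    exact ⟨hxy.1, hxy.2, fun h' => h ⟨_, hxy.1, h'⟩⟩

/-- Restriction of a 2-ECSS to one side of a cut vertex. -/
theorem restrict_part {V : Type*} [Fintype V] (G : SimpleGraph V) (S : Set V) [Fintype S]
    (hcard : 2 ≤ Fintype.card S) (u : V) (hu : u ∈ S)
    (hcut : ∀ a ∈ S, ∀ b, b ∉ S → G.Adj a b → a = u)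
    (F : Finset (Sym2 V)) (hF : IsTwoECSS G F) :
    IsTwoECSS (G.induce S) (Finset.univ.filter fun e => Sym2.map Subtype.val e ∈ F) := by
  obtain ⟨hs, hc, -, hd⟩ := hF
  set F' : Finset (Sym2 S) := Finset.univ.filter fun e => Sym2.map Subtype.val e ∈ F with hF'
  let r : V → S := fun v => if h : v ∈ S then ⟨v, h⟩ else ⟨u, hu⟩
  have hr : ∀ v (h : v ∈ S), r v = ⟨v, h⟩ := fun v h => dif_pos h
  have hr' : ∀ v, v ∉ S → r v = ⟨u, hu⟩ := fun v h => dif_neg h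
  have hsurj : Function.Surjective r := fun x => ⟨x, hr x x.2⟩
  have key : ∀ (K : SimpleGraph V) (L : SimpleGraph S), K ≤ G →
      (∀ a b : S, K.Adj a b → L.Adj a b) → K.Connected → L.Connected := by
    intro K L hKG hKL
    apply conn_push r hsurj
    intro a b hab
    by_cases ha : a ∈ S <;> by_cases hb : b ∈ S
    · rw [hr a ha, hr b hb]
      exact (hKL ⟨a, ha⟩ ⟨b, hb⟩ hab).reachable
    · have := hcut a ha b hb (hKG hab)
      subst this
      rw [hr a ha, hr' b hb]
    · have := hcut b hb a ha (hKG hab.symm)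
      subst this
      rw [hr b hb, hr' a ha]
    · rw [hr' b hb, hr' a ha]
  have hle : SimpleGraph.fromEdgeSet (↑F : Set (Sym2 V)) ≤ G := by
    intro a b h
    rw [SimpleGraph.fromEdgeSet_adj] at h
    exact hs h.1
  refine ⟨?_, ?_, hcard, ?_⟩
  · intro e he
    induction e using Sym2.ind with
    | _ x y =>
      have he : s((x : V), (y : V)) ∈ F := by simpa [hF'] using he
      exact hs he
  · refine key _ _ hle ?_ hc
    intro a b h
    rw [SimpleGraph.fromEdgeSet_adj] at h ⊢
    exact ⟨by simpa [hF'] using h.1, fun h' => h.2 (congrArg _ h')⟩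
  · intro e he
    have he : Sym2.map Subtype.val e ∈ F := by simpa [hF'] using he
    refine key _ _ ((SimpleGraph.deleteEdges_le _).trans hle) ?_ (hd _ he)
    intro a b h
    rw [SimpleGraph.deleteEdges_adj, SimpleGraph.fromEdgeSet_adj] at h ⊢
    refine ⟨⟨by simpa [hF'] using h.1.1, fun h' => h.1.2 (congrArg _ h')⟩, ?_⟩
    intro h'
    apply h.2
    have h' : s(a, b) = e := h'
    subst h'
    rfl

theorem wt_image {V : Type*} (S : Set V) (w : Sym2 V → ℕ) (F : Finset (Sym2 S)) :
    wt w (F.image (Sym2.map Subtype.val)) = wt (fun e => w (Sym2.map Subtype.val e)) F := by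
  unfold wt
  exact Finset.sum_image fun a _ b _ h => Sym2.map.injective Subtype.val_injective h

theorem opt_le {V : Type*} [Fintype V] (G : SimpleGraph V) (w : Sym2 V → ℕ)
    (F : Finset (Sym2 V)) (hF : IsTwoECSS G F) : opt G w ≤ wt w F :=
  Nat.sInf_le ⟨F, hF, rfl⟩

theorem stmt7 {V : Type*} [Fintype V]
    (α : ℝ) (hα : 3 / 2 ≤ α)
    (G : SimpleGraph V) (w : Sym2 V → ℕ)
    (hw : ∀ e ∈ G.edgeSet, w e ≤ 1) (hmatch : ZeroEdgesMatching G w)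
    (hG : TwoEdgeConnected G)
    (u : V) (V1 V2 : Set V)
    (hdisj : Disjoint V1 V2) (h1 : V1.Nonempty) (h2 : V2.Nonempty)
    (hcover : V1 ∪ V2 = {v : V | v ≠ u})
    (hnoedge : ∀ a ∈ V1, ∀ b ∈ V2, ¬ G.Adj a b)
    (F1 : Finset (Sym2 ↥(V1 ∪ {u} : Set V))) (F2 : Finset (Sym2 ↥(V2 ∪ {u} : Set V)))
    (hF1 : IsTwoECSS (G.induce (V1 ∪ {u})) F1)
    (hF2 : IsTwoECSS (G.induce (V2 ∪ {u})) F2)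
    (hb1 : (wt (fun e => w (Sym2.map Subtype.val e)) F1 : ℝ) ≤
      max (α * (opt (G.induce (V1 ∪ {u})) (fun e => w (Sym2.map Subtype.val e)) : ℝ) - 2)
        (opt (G.induce (V1 ∪ {u})) (fun e => w (Sym2.map Subtype.val e)) : ℝ))
    (hb2 : (wt (fun e => w (Sym2.map Subtype.val e)) F2 : ℝ) ≤
      max (α * (opt (G.induce (V2 ∪ {u})) (fun e => w (Sym2.map Subtype.val e)) : ℝ) - 2)
        (opt (G.induce (V2 ∪ {u})) (fun e => w (Sym2.map Subtype.val e)) : ℝ)) :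
    IsTwoECSS G (F1.image (Sym2.map Subtype.val) ∪ F2.image (Sym2.map Subtype.val)) ∧
    (wt w (F1.image (Sym2.map Subtype.val) ∪ F2.image (Sym2.map Subtype.val)) : ℝ) ≤
      max (α * (opt G w : ℝ) - 2) (opt G w : ℝ) := by
  have hcov : ∀ v, v = u ∨ v ∈ V1 ∨ v ∈ V2 := by
    intro v
    by_cases h : v = u
    · exact Or.inl h
    · right
      have : v ∈ V1 ∪ V2 := by rw [hcover]; exact h
      exact this
  have hu1 : u ∉ V1 := fun h => by
    have : u ∈ V1 ∪ V2 := Or.inl h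
    rw [hcover] at this
    exact this rfl
  have hu2 : u ∉ V2 := fun h => by
    have : u ∈ V1 ∪ V2 := Or.inr h
    rw [hcover] at this
    exact this rfl
  have hm1 : u ∈ V1 ∪ {u} := Or.inr rfl
  have hm2 : u ∈ V2 ∪ {u} := Or.inr rfl
  set E := F1.image (Sym2.map Subtype.val) ∪ F2.image (Sym2.map Subtype.val) with hE
  have hreach : ∀ e v, ((SimpleGraph.fromEdgeSet (↑E : Set (Sym2 V))).deleteEdges {e}).Reachable
      u v := by
    intro e v
    have r1 := reach_part _ _ F1 hF1 e E Finset.subset_union_left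
    have r2 := reach_part _ _ F2 hF2 e E Finset.subset_union_right
    rcases hcov v with h | h | h
    · rw [h]
    · exact r1 ⟨u, hm1⟩ ⟨v, Or.inl h⟩
    · exact r2 ⟨u, hm2⟩ ⟨v, Or.inl h⟩
  haveI : Nonempty V := ⟨u⟩
  have hconn : ∀ e, ((SimpleGraph.fromEdgeSet (↑E : Set (Sym2 V))).deleteEdges {e}).Connected :=
    fun e => ⟨fun a b => (hreach e a).symm.trans (hreach e b)⟩
  have hA : IsTwoECSS G E := by
    refine ⟨?_, (hconn s(u, u)).mono (SimpleGraph.deleteEdges_le _), hG.2.1, fun e _ => hconn e⟩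
    intro e he
    rcases Finset.mem_union.1 he with he | he
    · obtain ⟨e', h', rfl⟩ := Finset.mem_image.1 he
      have := hF1.1 h'
      induction e' using Sym2.ind with
      | _ x y => exact this
    · obtain ⟨e', h', rfl⟩ := Finset.mem_image.1 he
      have := hF2.1 h'
      induction e' using Sym2.ind with
      | _ x y => exact this
  refine ⟨hA, ?_⟩
  have hwE : wt w E ≤ wt (fun e => w (Sym2.map Subtype.val e)) F1 +
      wt (fun e => w (Sym2.map Subtype.val e)) F2 := by
    rw [← wt_image, ← wt_image]
    unfold wt
    rw [hE, ← Finset.sum_union_inter]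
    exact Nat.le_add_right _ _
  have hopt : opt (G.induce (V1 ∪ {u})) (fun e => w (Sym2.map Subtype.val e)) +
      opt (G.induce (V2 ∪ {u})) (fun e => w (Sym2.map Subtype.val e)) ≤ opt G w := by
    have hne : {n | ∃ F : Finset (Sym2 V), IsTwoECSS G F ∧ wt w F = n}.Nonempty := ⟨_, E, hA, rfl⟩
    obtain ⟨F, hF, hwF⟩ := Nat.sInf_mem hne
    change wt w F = opt G w at hwF
    rw [← hwF]
    have p1 := restrict_part G (V1 ∪ {u}) hF1.2.2.1 u hm1 (by
      intro a ha b hb hab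
      rcases ha with ha | ha
      · rcases hcov b with h | h | h
        · exact absurd (Or.inr h) hb
        · exact absurd (Or.inl h) hb
        · exact absurd hab (hnoedge a ha b h)
      · exact ha) F hF
    have p2 := restrict_part G (V2 ∪ {u}) hF2.2.2.1 u hm2 (by
      intro a ha b hb hab
      rcases ha with ha | ha
      · rcases hcov b with h | h | h
        · exact absurd (Or.inr h) hb
        · exact absurd hab.symm (hnoedge b h a ha)
        · exact absurd (Or.inl h) hb
      · exact ha) F hF
    refine (Nat.add_le_add (opt_le _ _ _ p1) (opt_le _ _ _ p2)).trans ?_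
    rw [← wt_image, ← wt_image]
    unfold wt
    rw [← Finset.sum_union]
    · apply Finset.sum_le_sum_of_subset
      intro e he
      rcases Finset.mem_union.1 he with he | he
      · obtain ⟨e', h', rfl⟩ := Finset.mem_image.1 he
        exact (Finset.mem_filter.1 h').2
      · obtain ⟨e', h', rfl⟩ := Finset.mem_image.1 he
        exact (Finset.mem_filter.1 h').2
    · rw [Finset.disjoint_left]
      intro e he1 he2
      obtain ⟨e1, h1', rfl⟩ := Finset.mem_image.1 he1
      obtain ⟨e2, h2', heq⟩ := Finset.mem_image.1 he2
      have hedge := hF.1 (Finset.mem_filter.1 h1').2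
      have honly : ∀ v ∈ Sym2.map Subtype.val e1, v = u := by
        intro v hv
        have hv2 := hv
        rw [← heq] at hv2
        obtain ⟨x, -, hx⟩ := Sym2.mem_map.1 hv
        obtain ⟨y, -, hy⟩ := Sym2.mem_map.1 hv2
        have hx' : v ∈ V1 ∪ {u} := hx ▸ x.2
        have hy' : v ∈ V2 ∪ {u} := hy ▸ y.2
        rcases hx' with hx' | hx'
        · rcases hy' with hy' | hy'
          · exact absurd hy' (Set.disjoint_left.1 hdisj hx')
          · exact hy'
        · exact hx'
      induction e1 using Sym2.ind with
      | _ x y =>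
        have hadj : G.Adj x y := hedge
        apply hadj.ne
        rw [honly x (Sym2.mem_mk_left _ _), honly y (Sym2.mem_mk_right _ _)]
  generalize opt (G.induce (V1 ∪ {u})) (fun e => w (Sym2.map Subtype.val e)) = o1 at *
  generalize opt (G.induce (V2 ∪ {u})) (fun e => w (Sym2.map Subtype.val e)) = o2 at *
  have hwE' : (wt w E : ℝ) ≤ wt (fun e => w (Sym2.map Subtype.val e)) F1 +
      wt (fun e => w (Sym2.map Subtype.val e)) F2 := by exact_mod_cast hwE
  have hopt' : (o1 : ℝ) + o2 ≤ opt G w := by exact_mod_cast hopt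
  have n1 : (0 : ℝ) ≤ o1 := Nat.cast_nonneg _
  have n2 : (0 : ℝ) ≤ o2 := Nat.cast_nonneg _
  rw [le_max_iff] at *
  have m1 : (o1 : ℝ) ≤ α * o1 := by nlinarith
  have m2 : (o2 : ℝ) ≤ α * o2 := by nlinarith
  have m3 : α * o1 + α * o2 ≤ α * (opt G w : ℝ) := by nlinarith
  rcases hb1 with hb1 | hb1 <;> rcases hb2 with hb2 | hb2
  · left; linarith
  · left; linarith
  · left; linarith
  · right; linarith
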